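/- Let Assumption A hold with γ as in (C1), and suppose the switched system ẋ = f(t,x,u,σ) is 0-GUAS w.r.t. S and UBEBS w.r.t. S with UBEBS gain α. Set χ = max{α, γ}. Then for every ε > 0 there exists δ > 0 such that every solution x ∈ T(t₀,u,σ) with t₀ ≥ 0, σ ∈ S, ∫_0^∞ χ(|u(τ)|) dτ ≤ δ and |x(t₀)| ≤ δ satisfies |x(t)| ≤ ε for all t ≥ t₀. -/

import Mathlib

open MeasureTheory Set Filter Topology

noncomputable section

/-- A class-`K` function: continuous and strictly increasing on `[0,∞)` with `φ 0 = 0`. -/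
def ClassK (φ : ℝ → ℝ) : Prop :=
  ContinuousOn φ (Set.Ici 0) ∧ StrictMonoOn φ (Set.Ici 0) ∧ φ 0 = 0

/-- A class-`K∞` function: class `K` and unbounded. -/
def ClassKInf (φ : ℝ → ℝ) : Prop :=
  ClassK φ ∧ Filter.Tendsto φ Filter.atTop Filter.atTop

/-- A class-`KL` function: `β (·, t)` is of class `K∞` for each `t ≥ 0` and `β (r, ·)`
decreases monotonically to `0` for each fixed `r ≥ 0`. -/
def ClassKL (β : ℝ → ℝ → ℝ) : Prop :=
  (∀ t, 0 ≤ t → ClassKInf fun r => β r t) ∧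
  (∀ r, 0 ≤ r → AntitoneOn (fun t => β r t) (Set.Ici 0) ∧
    Filter.Tendsto (fun t => β r t) Filter.atTop (nhds 0))

/-- A continuous positive definite function on `[0,∞)`. -/
def PosDefFun (φ : ℝ → ℝ) : Prop :=
  ContinuousOn φ (Set.Ici 0) ∧ φ 0 = 0 ∧ ∀ s, 0 < s → 0 < φ s

variable {Γ : Type*} {E : Type*} {F : Type*} {P : Type*}
  [NormedAddCommGroup E] [NormedSpace ℝ E]
  [NormedAddCommGroup F] [NormedSpace ℝ F]
  [NormedAddCommGroup P]
  [MeasurableSpace E] [MeasurableSpace F] [MeasurableSpace P]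

/-- A switching signal: piecewise constant with finitely many discontinuities on every
bounded interval of `[0,∞)`, and right-continuous. -/
def IsSwitchingSignal (σ : ℝ → Γ) : Prop :=
  ∀ b : ℝ, 0 < b → ∃ (n : ℕ) (t : ℕ → ℝ), t 0 = 0 ∧ (∀ i < n, t i < t (i + 1)) ∧ b ≤ t n ∧
    ∀ i < n, ∀ s ∈ Set.Ico (t i) (t (i + 1)), σ s = σ (t i)

/-- An admissible input: Lebesgue measurable and locally essentially bounded. -/
def IsInput (u : ℝ → F) : Prop :=
  Measurable u ∧ ∀ b : ℝ, ∃ C : ℝ, ∀ᵐ s ∂volume, s ∈ Set.Icc (0 : ℝ) b → ‖u s‖ ≤ C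

/-- A Carathéodory solution of `ẋ = f t x u σ` on the domain `D ⊆ [0,∞)` (an interval):
a continuous function satisfying the corresponding integral equation. -/
structure IsSolution (f : ℝ → E → F → Γ → E) (u : ℝ → F) (σ : ℝ → Γ)
    (D : Set ℝ) (x : ℝ → E) : Prop where
  ordConnected : D.OrdConnected
  subset_Ici : D ⊆ Set.Ici 0
  nonempty : D.Nonempty
  continuousOn : ContinuousOn x D
  intervalIntegrable : ∀ a ∈ D, ∀ b ∈ D,
    IntervalIntegrable (fun s => f s (x s) (u s) (σ s)) volume a b
  integral_eq : ∀ a ∈ D, ∀ b ∈ D, x b = x a + ∫ s in a..b, f s (x s) (u s) (σ s)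

/-- A maximally defined Carathéodory solution: one admitting no proper extension. -/
def IsMaximalSolution (f : ℝ → E → F → Γ → E) (u : ℝ → F) (σ : ℝ → Γ)
    (D : Set ℝ) (x : ℝ → E) : Prop :=
  IsSolution f u σ D x ∧
    ∀ D' : Set ℝ, ∀ x' : ℝ → E, IsSolution f u σ D' x' → D ⊆ D' → Set.EqOn x x' D → D' ⊆ D

/-- Standing regularity assumptions on `f`: vanishing at the origin for zero input,
Lebesgue measurable in `t`, continuous in `(ξ, μ)`. -/
def Regular (f : ℝ → E → F → Γ → E) : Prop :=
  (∀ t, 0 ≤ t → ∀ i, f t 0 0 i = 0) ∧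
  (∀ ξ μ i, Measurable fun t => f t ξ μ i) ∧
  (∀ t i, Continuous fun q : E × F => f t q.1 q.2 i)

/-- Forward completeness w.r.t. `S`. -/
def ForwardComplete (f : ℝ → E → F → Γ → E) (S : Set (ℝ → Γ)) : Prop :=
  ∀ t₀, 0 ≤ t₀ → ∀ u : ℝ → F, IsInput u → ∀ σ ∈ S, ∀ D x,
    IsMaximalSolution f u σ D x → t₀ ∈ D → Set.Ici t₀ ⊆ D

/-- iISS w.r.t. `S` with iISS gain `χ`. -/
def IISS (f : ℝ → E → F → Γ → E) (S : Set (ℝ → Γ)) (χ : ℝ → ℝ) : Prop :=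
  ForwardComplete f S ∧
  ∃ β ρ, ClassKL β ∧ ClassK ρ ∧
    ∀ t₀, 0 ≤ t₀ → ∀ u : ℝ → F, IsInput u → ∀ σ ∈ S, ∀ D x,
      IsMaximalSolution f u σ D x → t₀ ∈ D → ∀ t ∈ D, t₀ ≤ t →
        ‖x t‖ ≤ β ‖x t₀‖ (t - t₀) + ρ (∫ s in t₀..t, χ ‖u s‖)

/-- 0-GUAS w.r.t. `S`. -/
def ZeroGUAS (f : ℝ → E → F → Γ → E) (S : Set (ℝ → Γ)) : Prop :=
  ∃ β, ClassKL β ∧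
    ∀ t₀, 0 ≤ t₀ → ∀ σ ∈ S, ∀ D x,
      IsMaximalSolution f (fun _ => (0 : F)) σ D x → t₀ ∈ D → ∀ t ∈ D, t₀ ≤ t →
        ‖x t‖ ≤ β ‖x t₀‖ (t - t₀)

/-- UBEBS w.r.t. `S` with UBEBS gain `α`. -/
def UBEBS (f : ℝ → E → F → Γ → E) (S : Set (ℝ → Γ)) (α : ℝ → ℝ) : Prop :=
  ∃ α₁ α₂ c, ClassK α₁ ∧ ClassK α₂ ∧ 0 ≤ c ∧
    ∀ t₀, 0 ≤ t₀ → ∀ u : ℝ → F, IsInput u → ∀ σ ∈ S, ∀ D x,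
      IsMaximalSolution f u σ D x → t₀ ∈ D → ∀ t ∈ D, t₀ ≤ t →
        ‖x t‖ ≤ α₁ ‖x t₀‖ + α₂ (∫ s in t₀..t, α ‖u s‖) + c

/-- The total `χ`-energy `∫_0^∞ χ(|u(s)|) ds` of an input, as an extended nonnegative real. -/
def Energy (χ : ℝ → ℝ) (u : ℝ → F) : ENNReal :=
  ∫⁻ s in Set.Ioi (0 : ℝ), ENNReal.ofReal (χ ‖u s‖)

/-- `χ`-BEICS w.r.t. `S`: every solution corresponding to an input of finite `χ`-energy
is defined for all future times and converges to `0`. -/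
def BEICS (f : ℝ → E → F → Γ → E) (S : Set (ℝ → Γ)) (χ : ℝ → ℝ) : Prop :=
  ∀ t₀, 0 ≤ t₀ → ∀ u : ℝ → F, IsInput u → ∀ σ ∈ S, ∀ D x,
    IsMaximalSolution f u σ D x → t₀ ∈ D → Energy χ u ≠ ⊤ →
      Set.Ici t₀ ⊆ D ∧ Filter.Tendsto x Filter.atTop (nhds 0)

/-- Condition (C1) of Assumption A, with the class-`K` function `γ`. -/
def CondC1 (f : ℝ → E → F → Γ → E) (γ : ℝ → ℝ) : Prop :=
  ∃ N : ℝ → ℝ, (∀ r, 0 ≤ r → 0 < N r) ∧ MonotoneOn N (Set.Ici 0) ∧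
    ∀ t, 0 ≤ t → ∀ (ξ : E) (μ : F) (i : Γ), ‖f t ξ μ i‖ ≤ N ‖ξ‖ * (1 + γ ‖μ‖)

/-- Condition (C2) of Assumption A. -/
def CondC2 (f : ℝ → E → F → Γ → E) : Prop :=
  ∀ r, 0 < r → ∀ ε, 0 < ε → ∃ δ, 0 < δ ∧ ∀ t, 0 ≤ t → ∀ (i : Γ) (ξ : E) (μ : F),
    ‖ξ‖ ≤ r → ‖μ‖ ≤ δ → ‖f t ξ μ i - f t ξ 0 i‖ < ε

/-- Condition (C3) of Assumption A: `f (t, ξ, 0, i)` is locally Lipschitz in `ξ`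
uniformly in `t` and `i`. -/
def CondC3 (f : ℝ → E → F → Γ → E) : Prop :=
  ∀ K : Set E, IsCompact K → ∃ L, 0 ≤ L ∧ ∀ t, 0 ≤ t → ∀ (i : Γ), ∀ ξ ∈ K, ∀ ξ' ∈ K,
    ‖f t ξ 0 i - f t ξ' 0 i‖ ≤ L * ‖ξ - ξ'‖

/-- Assumption A, with `γ` the class-`K` function appearing in (C1). -/
def AssumptionA (f : ℝ → E → F → Γ → E) (γ : ℝ → ℝ) : Prop :=
  ClassK γ ∧ CondC1 f γ ∧ CondC2 f ∧ CondC3 f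

/-- Sandwich bounds `φ₁(|ξ|) ≤ V(t,ξ) ≤ φ₂(|ξ|)` with `φ₁, φ₂` of class `K∞`. -/
def StorageBounds (V : ℝ → E → ℝ) : Prop :=
  ∃ φ₁ φ₂, ClassKInf φ₁ ∧ ClassKInf φ₂ ∧
    ∀ t, 0 ≤ t → ∀ ξ : E, φ₁ ‖ξ‖ ≤ V t ξ ∧ V t ξ ≤ φ₂ ‖ξ‖

/-- 0-OD (zero-output dissipativity) w.r.t. `S` witnessed by the storage function `V`
and the supply function `α`. -/
def ZeroODWithStorage (f : ℝ → E → F → Γ → E) (S : Set (ℝ → Γ)) (V : ℝ → E → ℝ)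
    (α : ℝ → ℝ) : Prop :=
  StorageBounds V ∧
    ∀ t₀, 0 ≤ t₀ → ∀ u : ℝ → F, IsInput u → ∀ σ ∈ S, ∀ D x,
      IsMaximalSolution f u σ D x → t₀ ∈ D → ∀ t ∈ D, t₀ ≤ t →
        V t (x t) ≤ V t₀ (x t₀) + ∫ s in t₀..t, α ‖u s‖

/-- 0-OD w.r.t. `S` with supply function `α`. -/
def ZeroOD (f : ℝ → E → F → Γ → E) (S : Set (ℝ → Γ)) (α : ℝ → ℝ) : Prop :=
  ∃ V : ℝ → E → ℝ, (∀ t ξ, 0 ≤ V t ξ) ∧ ZeroODWithStorage f S V α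

/-- `h`-OD (output dissipativity) w.r.t. `S` with supply function `α`. -/
def HOD (f : ℝ → E → F → Γ → E) (h : ℝ → E → F → Γ → P) (S : Set (ℝ → Γ))
    (α : ℝ → ℝ) : Prop :=
  ∃ V : ℝ → E → ℝ, (∀ t ξ, 0 ≤ V t ξ) ∧ StorageBounds V ∧
    ∃ α₃, PosDefFun α₃ ∧
      ∀ t₀, 0 ≤ t₀ → ∀ u : ℝ → F, IsInput u → ∀ σ ∈ S, ∀ D x,
        IsMaximalSolution f u σ D x → t₀ ∈ D → ∀ t ∈ D, t₀ ≤ t →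
          V t (x t) ≤ V t₀ (x t₀) - (∫ s in t₀..t, α₃ ‖h s (x s) (u s) (σ s)‖)
            + ∫ s in t₀..t, α ‖u s‖

/-- The pair `(h, f)` is zero-input output-persistently exciting w.r.t. `S`. -/
def OutputPE (f : ℝ → E → F → Γ → E) (h : ℝ → E → F → Γ → P)
    (S : Set (ℝ → Γ)) : Prop :=
  ∀ ε : ℝ, 0 < ε → ε ≤ 1 → ∃ T, 0 < T ∧ ∃ r, 0 < r ∧
    ∀ t₀, 0 ≤ t₀ → ∀ σ ∈ S, ∀ D x,
      IsMaximalSolution f (fun _ => (0 : F)) σ D x → t₀ ∈ D →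
        ∀ t, t₀ ≤ t → Set.Icc t (t + T) ⊆ D →
          (∀ τ ∈ Set.Icc t (t + T), ε ≤ ‖x τ‖ ∧ ‖x τ‖ ≤ 1 / ε) →
            r ≤ ∫ τ in t..(t + T), ‖h τ (x τ) 0 (σ τ)‖ ^ 2

/-- Standing regularity assumptions on the output map `h`. -/
def OutputRegular (h : ℝ → E → F → Γ → P) : Prop :=
  (∀ ξ μ i, Measurable fun t => h t ξ μ i) ∧
  (∀ t i, Continuous fun q : E × F => h t q.1 q.2 i) ∧
  ∀ K : Set E, IsCompact K → (0 : E) ∉ K → ∃ M : ℝ,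
    ∀ᵐ t ∂volume, 0 ≤ t → ∀ ξ ∈ K, ∀ i : Γ, ‖h t ξ 0 i‖ ≤ M

theorem integral_exp_mul_le {c : ℝ} (hc : 0 < c) (a t : ℝ) :
    ∫ s in a..t, Real.exp (c * s) ≤ Real.exp (c * t) / c := by
  have hderiv : ∀ s ∈ uIcc a t,
      HasDerivAt (fun s => Real.exp (c * s) / c) (Real.exp (c * s)) s := by
    intro s _
    have h := (((hasDerivAt_id s).const_mul c).exp).div_const c
    simpa [hc.ne'] using h
  rw [intervalIntegral.integral_eq_sub_of_hasDerivAt hderiv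
    (Continuous.intervalIntegrable (by fun_prop) _ _)]
  have : 0 < Real.exp (c * a) / c := by positivity
  linarith

/-- Existence for the Carathéodory integral equation with a globally Lipschitz right-hand side. -/
theorem exists_integral_solution_of_lipschitz {X : Type*} [NormedAddCommGroup X]
    [NormedSpace ℝ X] [CompleteSpace X] {g : ℝ → X → X} {a b L : ℝ} (hab : a ≤ b) (hL : 0 ≤ L)
    (hlip : ∀ s ∈ Icc a b, ∀ ξ η, ‖g s ξ - g s η‖ ≤ L * ‖ξ - η‖)
    (hint : ∀ w : ℝ → X, Continuous w → IntervalIntegrable (fun s => g s (w s)) volume a b)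
    (z₀ : X) :
    ∃ z : ℝ → X, Continuous z ∧ ∀ t ∈ Icc a b, z t = z₀ + ∫ s in a..t, g s (z s) := by
  set c : ℝ := L + 1 with hc
  have hc0 : 0 < c := by positivity
  -- The factor `exp (c * s)` turns the Picard operator into a contraction for the sup norm.
  let W : C(Icc a b, X) → ℝ → X := fun y s => Real.exp (c * s) • y (projIcc a b hab s)
  have hW : ∀ y, Continuous (W y) := fun y => by
    have := y.continuous.comp (continuous_projIcc (h := hab))
    exact Continuous.smul (by fun_prop) this
  have hprim : ∀ y, Continuous fun t : Icc a b => ∫ s in a..(t : ℝ), g s (W y s) := fun y => by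
    have h := intervalIntegral.continuousOn_primitive_interval' (hint _ (hW y))
      (left_mem_uIcc (a := a) (b := b))
    rw [uIcc_of_le hab] at h
    exact continuousOn_iff_continuous_domRestrict.1 h
  let Φ : C(Icc a b, X) → C(Icc a b, X) := fun y =>
    ⟨fun t => Real.exp (-(c * t)) • (z₀ + ∫ s in a..(t : ℝ), g s (W y s)),
      Continuous.smul (by fun_prop) (continuous_const.add (hprim y))⟩
  have hΦ : ContractingWith (Real.toNNReal (L / c)) Φ := by
    have hq : 0 ≤ L / c := by positivity
    refine ⟨?_, LipschitzWith.of_dist_le_mul fun y₁ y₂ => ?_⟩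
    · rw [← NNReal.coe_lt_coe, Real.coe_toNNReal _ hq, NNReal.coe_one, div_lt_one hc0]
      linarith
    rw [Real.coe_toNNReal _ hq, ContinuousMap.dist_le (by positivity)]
    rintro ⟨t, ht⟩
    have hsub : uIcc a t ⊆ uIcc a b := by
      rw [uIcc_of_le ht.1, uIcc_of_le hab]
      exact Icc_subset_Icc_right ht.2
    have hi : ∀ y, IntervalIntegrable (fun s => g s (W y s)) volume a t := fun y =>
      (hint _ (hW y)).mono_set hsub
    have key : ‖(∫ s in a..t, g s (W y₁ s)) - ∫ s in a..t, g s (W y₂ s)‖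
        ≤ ∫ s in a..t, (L * dist y₁ y₂) * Real.exp (c * s) := by
      rw [← intervalIntegral.integral_sub (hi _) (hi _)]
      refine intervalIntegral.norm_integral_le_of_norm_le ht.1
        (Eventually.of_forall fun s hs => ?_) (Continuous.intervalIntegrable (by fun_prop) _ _)
      have hs' : s ∈ Icc a b := ⟨hs.1.le, hs.2.trans ht.2⟩
      refine (hlip s hs' _ _).trans ?_
      have h1 : ‖W y₁ s - W y₂ s‖ ≤ Real.exp (c * s) * dist y₁ y₂ := by
        rw [← smul_sub, norm_smul, Real.norm_of_nonneg (Real.exp_pos _).le, ← dist_eq_norm]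
        gcongr
        exact ContinuousMap.dist_apply_le_dist _
      calc L * ‖W y₁ s - W y₂ s‖ ≤ L * (Real.exp (c * s) * dist y₁ y₂) := by gcongr
        _ = _ := by ring
    have hexp := integral_exp_mul_le hc0 a t
    rw [intervalIntegral.integral_const_mul] at key
    change dist (Real.exp (-(c * t)) • (z₀ + ∫ s in a..t, g s (W y₁ s)))
      (Real.exp (-(c * t)) • (z₀ + ∫ s in a..t, g s (W y₂ s))) ≤ _
    rw [dist_eq_norm, ← smul_sub, add_sub_add_left_eq_sub, norm_smul,
      Real.norm_of_nonneg (Real.exp_pos _).le]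
    calc Real.exp (-(c * t)) * ‖(∫ s in a..t, g s (W y₁ s)) - ∫ s in a..t, g s (W y₂ s)‖
        ≤ Real.exp (-(c * t)) * ((L * dist y₁ y₂) * (Real.exp (c * t) / c)) := by
          gcongr
          exact key.trans (by gcongr)
      _ = (Real.exp (-(c * t)) * Real.exp (c * t)) * (L / c * dist y₁ y₂) := by ring
      _ = L / c * dist y₁ y₂ := by rw [← Real.exp_add]; simp
  have : Nonempty (Icc a b) := ⟨⟨a, left_mem_Icc.2 hab⟩⟩
  have hfix := hΦ.fixedPoint_isFixedPt
  set y := ContractingWith.fixedPoint Φ hΦ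
  refine ⟨W y, hW y, fun t ht => ?_⟩
  have h : y ⟨t, ht⟩ = Real.exp (-(c * t)) • (z₀ + ∫ s in a..t, g s (W y s)) :=
    (congrArg (fun v : C(Icc a b, X) => v ⟨t, ht⟩) hfix).symm
  calc W y t = Real.exp (c * t) • y ⟨t, ht⟩ := by simp only [W, projIcc_of_mem hab ht]
    _ = _ := by rw [h, smul_smul, ← Real.exp_add]; simp

/-- An integral form of Grönwall's inequality. -/
theorem le_mul_exp_of_le_add_integral {v : ℝ → ℝ} {a b K L : ℝ} (hL : 0 ≤ L) (hK : 0 ≤ K)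
    (hab : a ≤ b)
    (hv : ContinuousOn v (Icc a b))
    (h : ∀ t ∈ Icc a b, v t ≤ K + L * ∫ s in a..t, v s) :
    ∀ t ∈ Icc a b, v t ≤ K * ((L + 1) * Real.exp ((L + 1) * (t - a))) := by
  set c : ℝ := L + 1 with hc
  have hc0 : 0 < c := by positivity
  obtain ⟨t₁, ht₁, hmax⟩ := isCompact_Icc.exists_isMaxOn (nonempty_Icc.2 hab)
    (ContinuousOn.mul (f := fun t => Real.exp (-(c * (t - a)))) (by fun_prop) hv)
  set M : ℝ := Real.exp (-(c * (t₁ - a))) * v t₁ with hM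
  have hvM : ∀ t ∈ Icc a b, v t ≤ M * Real.exp (c * (t - a)) := fun t ht => by
    have h1 : Real.exp (-(c * (t - a))) * v t ≤ M := hmax ht
    calc v t = Real.exp (-(c * (t - a))) * v t * Real.exp (c * (t - a)) := by
          rw [mul_right_comm, ← Real.exp_add]; simp
      _ ≤ _ := by gcongr
  suffices hMK : M ≤ K * c from fun t ht => by
    calc v t ≤ M * Real.exp (c * (t - a)) := hvM t ht
      _ ≤ K * c * Real.exp (c * (t - a)) := by gcongr
      _ = _ := by ring
  by_cases hM0 : M ≤ 0
  · exact hM0.trans (by positivity)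
  push Not at hM0
  have hint : ∫ s in a..t₁, v s ≤ M * (Real.exp (c * (t₁ - a)) / c) := by
    have hmono : ∫ s in a..t₁, v s
        ≤ ∫ s in a..t₁, M * Real.exp (-(c * a)) * Real.exp (c * s) := by
      refine intervalIntegral.integral_mono_on ht₁.1 ?_
        (Continuous.intervalIntegrable (by fun_prop) _ _) fun s hs => ?_
      · refine ContinuousOn.intervalIntegrable (hv.mono ?_)
        rw [uIcc_of_le ht₁.1]
        exact Icc_subset_Icc_right ht₁.2
      · refine (hvM s ⟨hs.1, hs.2.trans ht₁.2⟩).trans_eq ?_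
        rw [mul_assoc M (Real.exp _) (Real.exp _), ← Real.exp_add]
        ring_nf
    rw [intervalIntegral.integral_const_mul] at hmono
    refine hmono.trans ?_
    calc _ ≤ M * Real.exp (-(c * a)) * (Real.exp (c * t₁) / c) := by
          gcongr
          exact integral_exp_mul_le hc0 _ _
      _ = M * ((Real.exp (-(c * a)) * Real.exp (c * t₁)) / c) := by ring
      _ = _ := by rw [← Real.exp_add]; ring_nf
  have h1 : v t₁ ≤ K + L * (M * (Real.exp (c * (t₁ - a)) / c)) :=
    (h t₁ ht₁).trans (by gcongr)
  have h2 : M ≤ K + L * (M / c) := by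
    have he : Real.exp (-(c * (t₁ - a))) ≤ 1 :=
      Real.exp_le_one_iff.2 (by nlinarith [ht₁.1, mul_nonneg hc0.le (sub_nonneg.2 ht₁.1)])
    calc M ≤ Real.exp (-(c * (t₁ - a))) * (K + L * (M * (Real.exp (c * (t₁ - a)) / c))) := by
          rw [hM]; gcongr
      _ = Real.exp (-(c * (t₁ - a))) * K
          + (Real.exp (-(c * (t₁ - a))) * Real.exp (c * (t₁ - a))) * (L * (M / c)) := by ring
      _ = Real.exp (-(c * (t₁ - a))) * K + L * (M / c) := by rw [← Real.exp_add]; simp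
      _ ≤ 1 * K + L * (M / c) := by gcongr
      _ = _ := by ring
  have h3 : L * (M / c) = M - M / c := by
    rw [hc]; field_simp; ring
  have h4 : M / c ≤ K := by linarith
  exact (div_le_iff₀ hc0).1 h4

/-- A continuous function that starts below `R`, and is below `R` at `t` whenever it has not
exceeded `R` up to time `t`, stays below `R`. -/
theorem lt_of_forall_le_imp_lt {v : ℝ → ℝ} {a b R : ℝ} (hv : ContinuousOn v (Icc a b))
    (ha : v a < R) (h : ∀ t ∈ Icc a b, (∀ s ∈ Icc a t, v s ≤ R) → v t < R) :
    ∀ t ∈ Icc a b, v t < R := by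
  by_contra! hcon
  obtain ⟨t, ht, htR⟩ := hcon
  have hclosed : IsCompact (Icc a b ∩ v ⁻¹' Ici R) :=
    isCompact_Icc.of_isClosed_subset (hv.preimage_isClosed_of_isClosed isClosed_Icc isClosed_Ici)
      inter_subset_left
  obtain ⟨t₁, ⟨ht₁, hR₁⟩, hleast⟩ := hclosed.exists_isLeast ⟨t, ht, htR⟩
  have hle : ∀ s ∈ Icc a t₁, v s ≤ R := fun s hs => by
    by_contra! hsR
    have hsb : s ≤ b := hs.2.trans ht₁.2
    obtain ⟨r, hr, hrR⟩ := intermediate_value_Icc hs.1 (hv.mono (Icc_subset_Icc_right hsb))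
      ⟨ha.le, hsR.le⟩
    have hrs : t₁ ≤ r := hleast ⟨⟨hr.1, hr.2.trans hsb⟩, hrR.ge⟩
    have : r = s := le_antisymm hr.2 (hs.2.trans hrs)
    exact absurd (this ▸ hrR) hsR.ne'
  exact absurd (h t₁ ht₁ hle) (not_lt.2 hR₁)

/-- Every solution extends to a maximal one. -/
theorem IsSolution.exists_isMaximalSolution {X Y Λ : Type*} [NormedAddCommGroup X]
    [NormedSpace ℝ X] {f : ℝ → X → Y → Λ → X} {u : ℝ → Y} {σ : ℝ → Λ}
    {D : Set ℝ} {x : ℝ → X} (hx : IsSolution f u σ D x) :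
    ∃ D' x', IsMaximalSolution f u σ D' x' ∧ D ⊆ D' ∧ EqOn x x' D := by
  classical
  let T := {p : Set ℝ × (ℝ → X) // IsSolution f u σ p.1 p.2 ∧ D ⊆ p.1 ∧ EqOn x p.2 D}
  let r : T → T → Prop := fun p q => p.1.1 ⊆ q.1.1 ∧ EqOn p.1.2 q.1.2 p.1.1
  have hrefl : ∀ p, r p p := fun p => ⟨Subset.rfl, fun _ _ => rfl⟩
  have htrans : ∀ {p q s}, r p q → r q s → r p s := fun h₁ h₂ =>
    ⟨h₁.1.trans h₂.1, fun t ht => (h₁.2 ht).trans (h₂.2 (h₁.1 ht))⟩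
  have hchain : ∀ c : Set T, IsChain r c → ∃ ub, ∀ p ∈ c, r p ub := by
    intro c hc
    rcases c.eq_empty_or_nonempty with rfl | ⟨p₀, hp₀⟩
    · exact ⟨⟨(D, x), hx, Subset.rfl, fun _ _ => rfl⟩, by simp⟩
    have htot : ∀ p ∈ c, ∀ q ∈ c, r p q ∨ r q p := fun p hp q hq => by
      by_cases h : p = q
      · exact Or.inl (h ▸ hrefl p)
      · exact hc hp hq h
    let U : Set ℝ := {t | ∃ p ∈ c, t ∈ p.1.1}
    let y : ℝ → X := fun t => if h : ∃ p ∈ c, t ∈ p.1.1 then h.choose.1.2 t else 0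
    have hy : ∀ p ∈ c, EqOn p.1.2 y p.1.1 := fun p hp t ht => by
      have h : ∃ p ∈ c, t ∈ p.1.1 := ⟨p, hp, ht⟩
      simp only [y, dif_pos h]
      rcases htot p hp _ h.choose_spec.1 with h' | h'
      · exact h'.2 ht
      · exact (h'.2 h.choose_spec.2).symm
    have hdir : ∀ p ∈ c, ∀ b ∈ U, ∃ q ∈ c, p.1.1 ⊆ q.1.1 ∧ b ∈ q.1.1 := by
      rintro p hp b ⟨q, hq, hb⟩
      rcases htot p hp q hq with h | h
      · exact ⟨q, hq, h.1, hb⟩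
      · exact ⟨p, hp, Subset.rfl, h.1 hb⟩
    have hpair : ∀ a ∈ U, ∀ b ∈ U, ∃ q ∈ c, a ∈ q.1.1 ∧ b ∈ q.1.1 := by
      rintro a ⟨p, hp, ha⟩ b hb
      obtain ⟨q, hq, hpq, hbq⟩ := hdir p hp b hb
      exact ⟨q, hq, hpq ha, hbq⟩
    have hsub : ∀ p ∈ c, p.1.1 ⊆ U := fun p hp t ht => ⟨p, hp, ht⟩
    have heq : ∀ p ∈ c, ∀ a ∈ p.1.1, ∀ b ∈ p.1.1, ∀ s ∈ uIcc a b,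
        f s (p.1.2 s) (u s) (σ s) = f s (y s) (u s) (σ s) := fun p hp a ha b hb s hs => by
      rw [hy p hp (p.2.1.ordConnected.uIcc_subset ha hb hs)]
    have hsol : IsSolution f u σ U y := by
      refine ⟨⟨?_⟩, ?_, ?_, ?_, ?_, ?_⟩
      · intro a ha b hb
        obtain ⟨q, hq, haq, hbq⟩ := hpair a ha b hb
        exact (q.2.1.ordConnected.out haq hbq).trans (hsub q hq)
      · rintro t ⟨p, -, ht⟩
        exact p.2.1.subset_Ici ht
      · exact p₀.2.1.nonempty.mono (hsub _ hp₀)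
      · intro t ht
        obtain ⟨p, hp, htp⟩ := ht
        obtain ⟨q, hq, htq, hnhds⟩ : ∃ q ∈ c, t ∈ q.1.1 ∧ q.1.1 ∈ 𝓝[U] t := by
          obtain ⟨q₁, hq₁, h₁, hr⟩ :
              ∃ q ∈ c, p.1.1 ⊆ q.1.1 ∧ ((∃ b ∈ q.1.1, t < b) ∨ ∀ b ∈ U, b ≤ t) := by
            by_cases h : ∃ b ∈ U, t < b
            · obtain ⟨b, hb, htb⟩ := h
              obtain ⟨q, hq, hpq, hbq⟩ := hdir p hp b hb
              exact ⟨q, hq, hpq, Or.inl ⟨b, hbq, htb⟩⟩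
            · push Not at h
              exact ⟨p, hp, Subset.rfl, Or.inr h⟩
          obtain ⟨q₂, hq₂, h₂, hl⟩ :
              ∃ q ∈ c, q₁.1.1 ⊆ q.1.1 ∧ ((∃ b ∈ q.1.1, b < t) ∨ ∀ b ∈ U, t ≤ b) := by
            by_cases h : ∃ b ∈ U, b < t
            · obtain ⟨b, hb, htb⟩ := h
              obtain ⟨q, hq, hpq, hbq⟩ := hdir q₁ hq₁ b hb
              exact ⟨q, hq, hpq, Or.inl ⟨b, hbq, htb⟩⟩
            · push Not at h
              exact ⟨q₁, hq₁, Subset.rfl, Or.inr h⟩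
          have htq : t ∈ q₂.1.1 := h₂ (h₁ htp)
          have hright : ∀ᶠ s in 𝓝[U] t, t ≤ s → s ∈ q₂.1.1 := by
            rcases hr with ⟨b, hb, htb⟩ | h
            · filter_upwards [mem_nhdsWithin_of_mem_nhds (Iio_mem_nhds htb)] with s hs hts
              exact q₂.2.1.ordConnected.out htq (h₂ hb) ⟨hts, le_of_lt hs⟩
            · filter_upwards [self_mem_nhdsWithin] with s hs hts
              rwa [le_antisymm (h s hs) hts]
          have hleft : ∀ᶠ s in 𝓝[U] t, s ≤ t → s ∈ q₂.1.1 := by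
            rcases hl with ⟨b, hb, htb⟩ | h
            · filter_upwards [mem_nhdsWithin_of_mem_nhds (Ioi_mem_nhds htb)] with s hs hts
              exact q₂.2.1.ordConnected.out hb htq ⟨le_of_lt hs, hts⟩
            · filter_upwards [self_mem_nhdsWithin] with s hs hts
              rwa [le_antisymm hts (h s hs)]
          refine ⟨q₂, hq₂, htq, ?_⟩
          filter_upwards [hright, hleft] with s hs₁ hs₂
          exact (le_total t s).elim hs₁ hs₂
        have hcont : ContinuousWithinAt y q.1.1 t :=
          (q.2.1.continuousOn t htq).congr (fun s hs => (hy q hq hs).symm) (hy q hq htq).symm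
        exact hcont.mono_of_mem_nhdsWithin hnhds
      · intro a ha b hb
        obtain ⟨q, hq, haq, hbq⟩ := hpair a ha b hb
        exact (q.2.1.intervalIntegrable a haq b hbq).congr fun s hs =>
          heq q hq a haq b hbq s (uIoc_subset_uIcc hs)
      · intro a ha b hb
        obtain ⟨q, hq, haq, hbq⟩ := hpair a ha b hb
        rw [← hy q hq haq, ← hy q hq hbq, q.2.1.integral_eq a haq b hbq,
          intervalIntegral.integral_congr (heq q hq a haq b hbq)]
    refine ⟨⟨(U, y), hsol, p₀.2.2.1.trans (hsub _ hp₀), fun t ht => ?_⟩,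
      fun p hp => ⟨hsub p hp, hy p hp⟩⟩
    exact (p₀.2.2.2 ht).trans (hy p₀ hp₀ (p₀.2.2.1 ht))
  obtain ⟨m, hm⟩ := exists_maximal_of_chains_bounded hchain htrans
  refine ⟨m.1.1, m.1.2, ⟨m.2.1, fun D' x' hx' hsub heq => ?_⟩, m.2.2.1, m.2.2.2⟩
  exact (hm ⟨(D', x'), hx', m.2.2.1.trans hsub,
    fun t ht => (m.2.2.2 ht).trans (heq (m.2.2.1 ht))⟩ ⟨hsub, heq⟩).1

theorem IsSwitchingSignal.intervalIntegrable {X Λ : Type*} [NormedAddCommGroup X]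
    [MeasurableSpace X] [BorelSpace X] [SecondCountableTopology X] {σ : ℝ → Λ}
    (hσ : IsSwitchingSignal σ) {G : ℝ → Λ → X} (hG : ∀ i, Measurable fun t => G t i) {C : ℝ}
    (hC : ∀ t, 0 ≤ t → ∀ i, ‖G t i‖ ≤ C) {a b : ℝ} (ha : 0 ≤ a) (hab : a ≤ b) :
    IntervalIntegrable (fun s => G s (σ s)) volume a b := by
  obtain ⟨n, t, ht0, hlt, hbn, hconst⟩ := hσ (b + 1) (by linarith)
  have hnonneg : ∀ k ≤ n, 0 ≤ t k := by
    intro k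
    induction k with
    | zero => exact fun _ => ht0.ge
    | succ k ih => exact fun hk => (ih (by omega)).trans (hlt k (by omega)).le
  have hpiece : ∀ k < n, IntervalIntegrable (fun s => G s (σ s)) volume (t k) (t (k + 1)) := by
    intro k hk
    rw [intervalIntegrable_iff_integrableOn_Ico_of_le (hlt k hk).le]
    have hbase : IntegrableOn (fun s => G s (σ (t k))) (Ico (t k) (t (k + 1))) volume := by
      refine Measure.integrableOn_of_bounded (M := C) (by simp) (hG _).aestronglyMeasurable ?_
      filter_upwards [ae_restrict_mem measurableSet_Ico] with s hs
      exact hC s ((hnonneg k hk.le).trans hs.1) _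
    refine hbase.congr_fun (fun s hs => ?_) measurableSet_Ico
    simp only [hconst k hk s hs]
  have hall := IntervalIntegrable.trans_iterate hpiece
  rw [ht0] at hall
  refine hall.mono_set ?_
  rw [uIcc_of_le hab, uIcc_of_le (hnonneg n le_rfl)]
  exact Icc_subset_Icc ha (by linarith)

/-- The coordinatewise truncation of a vector to the cube `[-R, R]ⁿ`. -/
def cubeClamp {n : ℕ} (R : ℝ) (ξ : EuclideanSpace ℝ (Fin n)) : EuclideanSpace ℝ (Fin n) :=
  WithLp.toLp 2 fun i => max (-R) (min R (ξ i))

theorem norm_cubeClamp_sub_le {n : ℕ} (R : ℝ) (ξ η : EuclideanSpace ℝ (Fin n)) :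
    ‖cubeClamp R ξ - cubeClamp R η‖ ≤ ‖ξ - η‖ := by
  rw [EuclideanSpace.norm_eq, EuclideanSpace.norm_eq]
  refine Real.sqrt_le_sqrt (Finset.sum_le_sum fun i _ => ?_)
  have h : |max (-R) (min R (ξ i)) - max (-R) (min R (η i))| ≤ |ξ i - η i| := by
    rw [max_comm (-R), max_comm (-R), min_comm R, min_comm R]
    exact (abs_max_sub_max_le_abs _ _ _).trans (abs_inf_sub_inf_le_abs _ _ _)
  simp only [PiLp.sub_apply, cubeClamp, Real.norm_eq_abs]
  gcongr

theorem cubeClamp_of_norm_le {n : ℕ} {R : ℝ} {ξ : EuclideanSpace ℝ (Fin n)} (h : ‖ξ‖ ≤ R) :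
    cubeClamp R ξ = ξ := by
  ext i
  have hi : |ξ i| ≤ R := (PiLp.norm_apply_le ξ i).trans h
  rw [abs_le] at hi
  simp only [cubeClamp, min_eq_right hi.2, max_eq_right hi.1]

theorem norm_cubeClamp_le {n : ℕ} {R : ℝ} (hR : 0 ≤ R) (ξ : EuclideanSpace ℝ (Fin n)) :
    ‖cubeClamp R ξ‖ ≤ √(n * R ^ 2) := by
  rw [EuclideanSpace.norm_eq]
  refine Real.sqrt_le_sqrt ?_
  calc ∑ i, ‖cubeClamp R ξ i‖ ^ 2 ≤ ∑ _i : Fin n, R ^ 2 := by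
        refine Finset.sum_le_sum fun i _ => ?_
        have : |max (-R) (min R (ξ i))| ≤ R :=
          abs_le.2 ⟨le_max_left _ _, max_le (by linarith) (min_le_left _ _)⟩
        simp only [cubeClamp, Real.norm_eq_abs]
        gcongr
    _ = n * R ^ 2 := by simp

theorem ClassK.nonneg {φ : ℝ → ℝ} (hφ : ClassK φ) {r : ℝ} (hr : 0 ≤ r) : 0 ≤ φ r :=
  hφ.2.2 ▸ hφ.2.1.monotoneOn self_mem_Ici hr hr

theorem ClassK.pos {φ : ℝ → ℝ} (hφ : ClassK φ) {r : ℝ} (hr : 0 < r) : 0 < φ r :=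
  hφ.2.2 ▸ hφ.2.1 self_mem_Ici hr.le hr

theorem ClassK.exists_pos_le_lt {φ : ℝ → ℝ} (hφ : ClassK φ) {ε : ℝ} (hε : 0 < ε) :
    ∃ δ, 0 < δ ∧ δ ≤ ε ∧ φ δ < ε := by
  have h : ∀ᶠ r in 𝓝[>] (0 : ℝ), φ r < ε := by
    have hcont := (hφ.1 0 self_mem_Ici).mono Ioi_subset_Ici_self
    exact hcont.eventually_lt continuousWithinAt_const (by rwa [hφ.2.2])
  obtain ⟨δ, hδ, hδε⟩ := (h.and (Ioc_mem_nhdsGT hε)).exists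
  exact ⟨δ, hδε.1, hδε.2, hδ⟩

theorem ClassK.measurable_comp_norm {Y : Type*} [NormedAddCommGroup Y] [MeasurableSpace Y]
    [OpensMeasurableSpace Y] {φ : ℝ → ℝ} (hφ : ClassK φ) {u : ℝ → Y} (hu : Measurable u) :
    Measurable fun s => φ ‖u s‖ := by
  have hcont : Continuous fun r => φ (max 0 r) :=
    hφ.1.comp_continuous (by fun_prop) fun r => mem_Ici.2 (le_max_left _ _)
  simpa [Function.comp_def] using hcont.measurable.comp hu.norm

theorem intervalIntegrable_and_integral_le_of_energy_le {Y : Type*} [NormedAddCommGroup Y]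
    [MeasurableSpace Y] [OpensMeasurableSpace Y] {γ χ : ℝ → ℝ} (hγ : ClassK γ)
    (hγχ : ∀ r, γ r ≤ χ r) {u : ℝ → Y} (hu : Measurable u) {δ : ℝ} (hδ : 0 ≤ δ)
    (hE : Energy χ u ≤ ENNReal.ofReal δ) {a b : ℝ} (ha : 0 ≤ a) (hab : a ≤ b) :
    IntervalIntegrable (fun s => γ ‖u s‖) volume a b ∧ ∫ s in a..b, γ ‖u s‖ ≤ δ := by
  have hle : ∫⁻ s in Ioc a b, ENNReal.ofReal (γ ‖u s‖) ≤ ENNReal.ofReal δ :=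
    calc ∫⁻ s in Ioc a b, ENNReal.ofReal (γ ‖u s‖)
        ≤ ∫⁻ s in Ioi 0, ENNReal.ofReal (γ ‖u s‖) :=
          lintegral_mono_set fun s hs => lt_of_le_of_lt ha hs.1
      _ ≤ Energy χ u := lintegral_mono fun s => ENNReal.ofReal_le_ofReal (hγχ _)
      _ ≤ _ := hE
  have hmeas := hγ.measurable_comp_norm hu
  have hpos : 0 ≤ᵐ[volume.restrict (Ioc a b)] fun s => γ ‖u s‖ :=
    Eventually.of_forall fun s => hγ.nonneg (norm_nonneg _)
  refine ⟨?_, ?_⟩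
  · rw [intervalIntegrable_iff_integrableOn_Ioc_of_le hab]
    refine ⟨hmeas.aestronglyMeasurable, ?_⟩
    rw [hasFiniteIntegral_iff_ofReal hpos]
    exact hle.trans_lt ENNReal.ofReal_lt_top
  · rw [intervalIntegral.integral_of_le hab,
      integral_eq_lintegral_of_nonneg_ae hpos hmeas.aestronglyMeasurable]
    exact ENNReal.toReal_le_of_le_ofReal hδ hle

/-- On bounded sets the effect of the input on the vector field is bounded by an arbitrarily
small constant plus a multiple of `γ (‖μ‖)`. -/
theorem exists_input_perturbation_bound {X Y Λ : Type*} [NormedAddCommGroup X]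
    [NormedAddCommGroup Y] {f : ℝ → X → Y → Λ → X}
    {γ : ℝ → ℝ} (hγ : ClassK γ) (h₁ : CondC1 f γ) (h₂ : CondC2 f) {R κ : ℝ} (hR : 0 < R)
    (hκ : 0 < κ) :
    ∃ C, 0 < C ∧ ∀ t, 0 ≤ t → ∀ i ξ μ, ‖ξ‖ ≤ R →
      ‖f t ξ μ i - f t ξ 0 i‖ ≤ κ + C * γ ‖μ‖ := by
  obtain ⟨N, hN, hNmono, hf⟩ := h₁
  obtain ⟨ρ, hρ, hsmall⟩ := h₂ R hR κ hκ
  have hγρ := hγ.pos hρ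
  have hNR := hN R hR.le
  refine ⟨N R * (2 / γ ρ + 1), by positivity, fun t ht i ξ μ hξ => ?_⟩
  have hγμ := hγ.nonneg (norm_nonneg μ)
  rcases le_or_gt ‖μ‖ ρ with hμ | hμ
  · have : 0 ≤ N R * (2 / γ ρ + 1) * γ ‖μ‖ := by positivity
    linarith [hsmall t ht i ξ μ hξ hμ]
  have hNξ : N ‖ξ‖ ≤ N R := hNmono (norm_nonneg ξ) hR.le hξ
  have hb₁ : ‖f t ξ μ i‖ ≤ N R * (1 + γ ‖μ‖) := (hf t ht ξ μ i).trans (by gcongr)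
  have hb₂ : ‖f t ξ 0 i‖ ≤ N R := by
    have h := hf t ht ξ 0 i
    rw [norm_zero, hγ.2.2, add_zero, mul_one] at h
    exact h.trans hNξ
  have hlt : 1 ≤ γ ‖μ‖ / γ ρ :=
    (one_le_div hγρ).2 (hγ.2.1 hρ.le (norm_nonneg μ) hμ).le
  calc ‖f t ξ μ i - f t ξ 0 i‖ ≤ N R * (1 + γ ‖μ‖) + N R :=
        (norm_sub_le _ _).trans (add_le_add hb₁ hb₂)
    _ = N R * (2 * 1 + γ ‖μ‖) := by ring
    _ ≤ N R * (2 * (γ ‖μ‖ / γ ρ) + γ ‖μ‖) := by gcongr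
    _ = N R * (2 / γ ρ + 1) * γ ‖μ‖ := by ring
    _ ≤ κ + N R * (2 / γ ρ + 1) * γ ‖μ‖ := by linarith

theorem isSolution_Icc_of_integral_eq {X Y Λ : Type*} [NormedAddCommGroup X]
    [NormedSpace ℝ X] {f : ℝ → X → Y → Λ → X} {u : ℝ → Y} {σ : ℝ → Λ}
    {a b : ℝ} {x : ℝ → X} (ha : 0 ≤ a) (hab : a ≤ b) (hx : ContinuousOn x (Icc a b))
    (hint : IntervalIntegrable (fun s => f s (x s) (u s) (σ s)) volume a b)
    (heq : ∀ t ∈ Icc a b, x t = x a + ∫ s in a..t, f s (x s) (u s) (σ s)) :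
    IsSolution f u σ (Icc a b) x := by
  have hsub : ∀ p ∈ Icc a b, ∀ q ∈ Icc a b,
      IntervalIntegrable (fun s => f s (x s) (u s) (σ s)) volume p q := fun p hp q hq =>
    hint.mono_set (by rw [uIcc_of_le hab]; exact ordConnected_Icc.uIcc_subset hp hq)
  have haI : a ∈ Icc a b := left_mem_Icc.2 hab
  refine ⟨ordConnected_Icc, fun t ht => ha.trans ht.1, ⟨a, haI⟩, hx, hsub, fun p hp q hq => ?_⟩
  rw [heq p hp, heq q hq, add_assoc,
    intervalIntegral.integral_add_adjacent_intervals (hsub a haI p hp) (hsub p hp q hq)]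

theorem IsSolution.mono {X Y Λ : Type*} [NormedAddCommGroup X]
    [NormedSpace ℝ X] {f : ℝ → X → Y → Λ → X} {u : ℝ → Y} {σ : ℝ → Λ}
    {D D' : Set ℝ} {x : ℝ → X} (hx : IsSolution f u σ D x) (hsub : D' ⊆ D)
    (hord : D'.OrdConnected) (hne : D'.Nonempty) : IsSolution f u σ D' x :=
  ⟨hord, hsub.trans hx.subset_Ici, hne, hx.continuousOn.mono hsub,
    fun a ha b hb => hx.intervalIntegrable a (hsub ha) b (hsub hb),
    fun a ha b hb => hx.integral_eq a (hsub ha) b (hsub hb)⟩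

/-- Under an a priori bound, zero-input solutions exist on any prescribed interval. -/
theorem exists_zero_input_isSolution {n m : ℕ} {Λ : Type*}
    {f : ℝ → EuclideanSpace ℝ (Fin n) → EuclideanSpace ℝ (Fin m) → Λ → EuclideanSpace ℝ (Fin n)}
    (hreg : Regular f) {γ : ℝ → ℝ} (hA : AssumptionA f γ) {σ : ℝ → Λ}
    (hσ : IsSwitchingSignal σ) {R a b : ℝ} (ha : 0 ≤ a) (hab : a ≤ b)
    {z₀ : EuclideanSpace ℝ (Fin n)} (hz₀ : ‖z₀‖ < R)
    (hbound : ∀ t ∈ Icc a b, ∀ z, IsSolution f (fun _ => 0) σ (Icc a t) z → z a = z₀ →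
      ‖z t‖ < R) :
    ∃ z, IsSolution f (fun _ => 0) σ (Icc a b) z ∧ z a = z₀ ∧ ∀ t ∈ Icc a b, ‖z t‖ < R := by
  obtain ⟨hγ, ⟨N, hN, hNmono, hf⟩, -, hC3⟩ := hA
  have hR : 0 < R := (norm_nonneg _).trans_lt hz₀
  set M : ℝ := √(n * R ^ 2)
  obtain ⟨L, hL, hlip⟩ := hC3 (Metric.closedBall 0 M) (isCompact_closedBall _ _)
  have hclamp : ∀ ξ : EuclideanSpace ℝ (Fin n), cubeClamp R ξ ∈ Metric.closedBall 0 M := fun ξ =>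
    mem_closedBall_zero_iff.2 (norm_cubeClamp_le hR.le ξ)
  have hclampCont : Continuous (cubeClamp R : EuclideanSpace ℝ (Fin n) → _) :=
    (LipschitzWith.of_dist_le_mul (K := 1) fun ξ η => by
      simpa [dist_eq_norm] using norm_cubeClamp_sub_le R ξ η).continuous
  have hmeas : ∀ w : ℝ → EuclideanSpace ℝ (Fin n), Continuous w → ∀ i,
      Measurable fun t => f t (cubeClamp R (w t)) 0 i := fun w hw i => by
    have h : Measurable (Function.uncurry fun ξ t => f t ξ 0 i) :=
      measurable_uncurry_of_continuous_of_measurable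
        (fun t => (hreg.2.2 t i).comp (Continuous.prodMk_left 0))
        (fun ξ => hreg.2.1 ξ 0 i)
    exact h.comp ((hclampCont.comp hw).measurable.prodMk measurable_id)
  have hbdd : ∀ w : ℝ → EuclideanSpace ℝ (Fin n), ∀ t, 0 ≤ t → ∀ i,
      ‖f t (cubeClamp R (w t)) 0 i‖ ≤ N M := fun w t ht i => by
    have h := hf t ht (cubeClamp R (w t)) 0 i
    rw [norm_zero, hγ.2.2, add_zero, mul_one] at h
    exact h.trans (hNmono (norm_nonneg _) (Real.sqrt_nonneg _) (norm_cubeClamp_le hR.le _))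
  have hint : ∀ w : ℝ → EuclideanSpace ℝ (Fin n), Continuous w →
      IntervalIntegrable (fun s => f s (cubeClamp R (w s)) 0 (σ s)) volume a b := fun w hw =>
    hσ.intervalIntegrable (hmeas w hw) (hbdd w) ha hab
  obtain ⟨z, hzcont, hz⟩ := exists_integral_solution_of_lipschitz
    (g := fun s ξ => f s (cubeClamp R ξ) 0 (σ s)) hab hL
    (fun s hs ξ η => (hlip s (ha.trans hs.1) _ _ (hclamp ξ) _ (hclamp η)).trans
      (mul_le_mul_of_nonneg_left (norm_cubeClamp_sub_le R ξ η) hL)) hint z₀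
  have hza : z a = z₀ := by simpa using hz a (left_mem_Icc.2 hab)
  have hsol : ∀ t ∈ Icc a b, (∀ s ∈ Icc a t, ‖z s‖ ≤ R) →
      IsSolution f (fun _ => 0) σ (Icc a t) z := fun t ht hzR => by
    have hcongr : ∀ r ∈ Icc a t, ∀ s ∈ uIcc a r,
        f s (cubeClamp R (z s)) 0 (σ s) = f s (z s) 0 (σ s) := fun r hr s hs => by
      rw [uIcc_of_le hr.1] at hs
      rw [cubeClamp_of_norm_le (hzR s ⟨hs.1, hs.2.trans hr.2⟩)]
    refine isSolution_Icc_of_integral_eq ha ht.1 hzcont.continuousOn ?_ fun r hr => ?_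
    · refine ((hint z hzcont).mono_set ?_).congr fun s hs =>
        hcongr t (right_mem_Icc.2 ht.1) s (uIoc_subset_uIcc hs)
      rw [uIcc_of_le ht.1, uIcc_of_le hab]
      exact Icc_subset_Icc_right ht.2
    · rw [hz r ⟨hr.1, hr.2.trans ht.2⟩, hza, intervalIntegral.integral_congr (hcongr r hr)]
  have hlt : ∀ t ∈ Icc a b, ‖z t‖ < R :=
    lt_of_forall_le_imp_lt hzcont.norm.continuousOn (by rwa [hza]) fun t ht h =>
      hbound t ht z (hsol t ht h) hza
  exact ⟨z, hsol b (right_mem_Icc.2 hab) fun s hs => (hlt s hs).le, hza, hlt⟩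

/-- Comparison of a solution with the zero-input solution that has the same initial value. -/
theorem norm_sub_le_of_isSolution {X Y Λ : Type*} [NormedAddCommGroup X]
    [NormedSpace ℝ X] [NormedAddCommGroup Y] {f : ℝ → X → Y → Λ → X} {u : ℝ → Y} {σ : ℝ → Λ}
    {γ : ℝ → ℝ} {a t κ C L T R δ : ℝ} {x z : ℝ → X} (hat : a ≤ t) (htT : t - a ≤ T)
    (hκ : 0 ≤ κ) (hC : 0 ≤ C) (hL : 0 ≤ L) (hδ : 0 ≤ δ) (hγ : ∀ r, 0 ≤ r → 0 ≤ γ r)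
    (hx : IsSolution f u σ (Icc a t) x) (hz : IsSolution f (fun _ => 0) σ (Icc a t) z)
    (hxz : x a = z a) (hxR : ∀ s ∈ Icc a t, ‖x s‖ ≤ R) (hzR : ∀ s ∈ Icc a t, ‖z s‖ ≤ R)
    (hlip : ∀ s, 0 ≤ s → ∀ i, ∀ ξ ∈ Metric.closedBall (0 : X) R,
      ∀ η ∈ Metric.closedBall (0 : X) R, ‖f s ξ 0 i - f s η 0 i‖ ≤ L * ‖ξ - η‖)
    (hpert : ∀ s, 0 ≤ s → ∀ i ξ μ, ‖ξ‖ ≤ R → ‖f s ξ μ i - f s ξ 0 i‖ ≤ κ + C * γ ‖μ‖)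
    (hu : IntervalIntegrable (fun s => γ ‖u s‖) volume a t)
    (huδ : ∫ s in a..t, γ ‖u s‖ ≤ δ) :
    ‖x t - z t‖ ≤ (κ * T + C * δ) * ((L + 1) * Real.exp ((L + 1) * T)) := by
  have haI : a ∈ Icc a t := left_mem_Icc.2 hat
  have hT : 0 ≤ T := (sub_nonneg.2 hat).trans htT
  have hcont : ContinuousOn (fun s => ‖x s - z s‖) (Icc a t) :=
    (hx.continuousOn.sub hz.continuousOn).norm
  have hgron : ∀ r ∈ Icc a t, ‖x r - z r‖ ≤ (κ * T + C * δ) + L * ∫ s in a..r, ‖x s - z s‖ := by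
    intro r hr
    have hsub : uIcc a r ⊆ uIcc a t := by
      rw [uIcc_of_le hr.1, uIcc_of_le hat]
      exact Icc_subset_Icc_right hr.2
    have hur : IntervalIntegrable (fun s => γ ‖u s‖) volume a r := hu.mono_set hsub
    have hdr : IntervalIntegrable (fun s => ‖x s - z s‖) volume a r := by
      refine ContinuousOn.intervalIntegrable (hcont.mono ?_)
      rwa [uIcc_of_le hat] at hsub
    have hurδ : ∫ s in a..r, γ ‖u s‖ ≤ δ :=
      (intervalIntegral.integral_mono_interval le_rfl hr.1 hr.2
        (Eventually.of_forall fun s => hγ _ (norm_nonneg _)) hu).trans huδ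
    have hsplit : x r - z r
        = ∫ s in a..r, (f s (x s) (u s) (σ s) - f s (z s) 0 (σ s)) := by
      rw [intervalIntegral.integral_sub (hx.intervalIntegrable a haI r hr)
        (hz.intervalIntegrable a haI r hr), hx.integral_eq a haI r hr,
        hz.integral_eq a haI r hr, hxz, add_sub_add_left_eq_sub]
    rw [hsplit]
    calc ‖∫ s in a..r, (f s (x s) (u s) (σ s) - f s (z s) 0 (σ s))‖
        ≤ ∫ s in a..r, ((κ + C * γ ‖u s‖) + L * ‖x s - z s‖) := by
          refine intervalIntegral.norm_integral_le_of_norm_le hr.1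
            (Eventually.of_forall fun s hs => ?_)
            ((intervalIntegrable_const.add (hur.const_mul C)).add (hdr.const_mul L))
          have hs' : s ∈ Icc a t := ⟨hs.1.le, hs.2.trans hr.2⟩
          have hs0 : 0 ≤ s := hx.subset_Ici hs'
          refine (norm_sub_le_norm_sub_add_norm_sub _ (f s (x s) 0 (σ s)) _).trans
            (add_le_add (hpert s hs0 _ _ _ (hxR s hs')) (hlip s hs0 _ _ ?_ _ ?_))
          · exact mem_closedBall_zero_iff.2 (hxR s hs')
          · exact mem_closedBall_zero_iff.2 (hzR s hs')
      _ = (κ * (r - a) + C * ∫ s in a..r, γ ‖u s‖) + L * ∫ s in a..r, ‖x s - z s‖ := by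
          rw [intervalIntegral.integral_add (intervalIntegrable_const.add (hur.const_mul C))
            (hdr.const_mul L), intervalIntegral.integral_add intervalIntegrable_const
            (hur.const_mul C), intervalIntegral.integral_const_mul,
            intervalIntegral.integral_const_mul, intervalIntegral.integral_const, smul_eq_mul,
            mul_comm κ]
      _ ≤ _ := by
          have : r - a ≤ T := by linarith [hr.2]
          gcongr
  calc ‖x t - z t‖ ≤ (κ * T + C * δ) * ((L + 1) * Real.exp ((L + 1) * (t - a))) :=
        le_mul_exp_of_le_add_integral hL (by positivity) hat hcont hgron t (right_mem_Icc.2 hat)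
    _ ≤ _ := by gcongr

/-- uniform stability step in the proof of Lemma `0UBEBS`: under
Assumption A with `γ` as in (C1), if the system is 0-GUAS w.r.t. `S` and UBEBS w.r.t. `S`
with gain `α`, then with `χ = max {α, γ}`: for every `ε > 0` there exists `δ > 0` such that
any solution with `∫_0^∞ χ(|u|) ≤ δ` and `|x(t₀)| ≤ δ` satisfies `|x(t)| ≤ ε` for `t ≥ t₀`. -/
theorem stmt10 {n m : ℕ} {Γ : Type*} [Nonempty Γ]
    (f : ℝ → EuclideanSpace ℝ (Fin n) → EuclideanSpace ℝ (Fin m) → Γ → EuclideanSpace ℝ (Fin n))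
    (hreg : Regular f)
    (S : Set (ℝ → Γ)) (hS : ∀ σ ∈ S, IsSwitchingSignal σ)
    (γ : ℝ → ℝ) (hA : AssumptionA f γ)
    (α : ℝ → ℝ) (hα : ClassK α)
    (hGUAS : ZeroGUAS f S) (hUBEBS : UBEBS f S α) :
    ∀ ε, 0 < ε → ∃ δ, 0 < δ ∧
      ∀ t₀, 0 ≤ t₀ → ∀ u, IsInput u →
        Energy (fun s => max (α s) (γ s)) u ≤ ENNReal.ofReal δ → ∀ σ ∈ S, ∀ D x,
          IsMaximalSolution f u σ D x → t₀ ∈ D → ‖x t₀‖ ≤ δ →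
            ∀ t ∈ D, t₀ ≤ t → ‖x t‖ ≤ ε := by
  obtain ⟨β, hβ, hGUAS⟩ := hGUAS
  obtain ⟨hγ, hC1, hC2, hC3⟩ := hA
  intro ε hε
  obtain ⟨δ₁, hδ₁, hδ₁ε, hβδ₁⟩ := (hβ.1 0 le_rfl).1.exists_pos_le_lt (half_pos hε)
  obtain ⟨T, hβT, hT⟩ := (((hβ.2 δ₁ hδ₁.le).2.eventually_lt_const (half_pos hδ₁)).and
    (eventually_gt_atTop 0)).exists
  have hzero : ∀ σ ∈ S, ∀ a, 0 ≤ a → ∀ t, a ≤ t → ∀ z,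
      IsSolution f (fun _ => 0) σ (Icc a t) z → ‖z a‖ ≤ δ₁ → ‖z t‖ ≤ β δ₁ (t - a) := by
    intro σ hσ a ha t hat z hz hza
    obtain ⟨D', z', hmax, hsub, heq⟩ := hz.exists_isMaximalSolution
    have haI : a ∈ Icc a t := left_mem_Icc.2 hat
    have htI : t ∈ Icc a t := right_mem_Icc.2 hat
    have h := hGUAS a ha σ hσ D' z' hmax (hsub haI) t (hsub htI) hat
    rw [← heq haI, ← heq htI] at h
    exact h.trans ((hβ.1 (t - a) (sub_nonneg.2 hat)).1.2.1.monotoneOn (norm_nonneg _) hδ₁.le hza)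
  have hβ0 : ∀ s, 0 ≤ s → β δ₁ s < ε / 2 := fun s hs =>
    ((hβ.2 δ₁ hδ₁.le).1 self_mem_Ici hs hs).trans_lt hβδ₁
  obtain ⟨L, hL, hlip⟩ := hC3 (Metric.closedBall 0 ε) (isCompact_closedBall _ _)
  set Q : ℝ := (L + 1) * Real.exp ((L + 1) * T)
  have hQ : 0 < Q := by positivity
  set η : ℝ := min (ε / 2) (δ₁ / 2)
  have hη : 0 < η := by positivity
  set κ : ℝ := η / (2 * T * Q) with hκdef
  have hκ : 0 < κ := by positivity
  obtain ⟨C, hC, hpert⟩ := exists_input_perturbation_bound hγ hC1 hC2 hε hκ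
  refine ⟨min δ₁ (η / (2 * C * Q)), by positivity, ?_⟩
  set δ : ℝ := min δ₁ (η / (2 * C * Q))
  have hδ : 0 < δ := by positivity
  have hsmall : (κ * T + C * δ) * Q ≤ η := by
    calc (κ * T + C * δ) * Q ≤ (κ * T + C * (η / (2 * C * Q))) * Q := by
          gcongr
          exact min_le_right _ _
      _ = η := by rw [hκdef]; field_simp; norm_num
  intro t₀ ht₀ u hu hE σ hσ D x hx ht₀D hxt₀
  have hstep : ∀ a ∈ D, ‖x a‖ ≤ δ₁ → ∀ t ∈ D, a ≤ t → t ≤ a + T →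
      ‖x t‖ < ε ∧ (t = a + T → ‖x t‖ ≤ δ₁) := by
    intro a haD hxa t htD hat htT
    have ha : 0 ≤ a := hx.1.subset_Ici haD
    have hIccD : Icc a t ⊆ D := hx.1.ordConnected.out haD htD
    obtain ⟨z, hz, hza, hzε⟩ := exists_zero_input_isSolution hreg ⟨hγ, hC1, hC2, hC3⟩
      (hS σ hσ) ha hat (z₀ := x a) (R := ε) (by linarith) fun s hs z hz hza => by
        have h₁ := hzero σ hσ a ha s hs.1 z hz (by rwa [hza])
        have h₂ := hβ0 (s - a) (sub_nonneg.2 hs.1)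
        linarith
    have hrestrict : ∀ s ∈ Icc a t, Icc a s ⊆ Icc a t := fun s hs => Icc_subset_Icc_right hs.2
    have hzs : ∀ s ∈ Icc a t, IsSolution f (fun _ => 0) σ (Icc a s) z := fun s hs =>
      hz.mono (hrestrict s hs) ordConnected_Icc (nonempty_Icc.2 hs.1)
    have hclose : ∀ s ∈ Icc a t, (∀ r ∈ Icc a s, ‖x r‖ ≤ ε) → ‖x s - z s‖ ≤ η := by
      intro s hs hxε
      obtain ⟨hint, hle⟩ := intervalIntegrable_and_integral_le_of_energy_le hγ
        (fun r => le_max_right (α r) (γ r)) hu.1 hδ.le hE ha hs.1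
      exact (norm_sub_le_of_isSolution hs.1 (by linarith [hs.2]) hκ.le hC.le hL hδ.le
        (fun r hr => hγ.nonneg hr)
        (hx.1.mono ((hrestrict s hs).trans hIccD) ordConnected_Icc (nonempty_Icc.2 hs.1))
        (hzs s hs) hza.symm hxε
        (fun r hr => (hzε r (hrestrict s hs hr)).le) hlip hpert hint hle).trans hsmall
    have hnorm : ∀ s, ‖x s‖ ≤ ‖z s‖ + ‖x s - z s‖ := fun s => by
      simpa using norm_add_le (z s) (x s - z s)
    have hzbound : ∀ s ∈ Icc a t, ‖z s‖ ≤ β δ₁ (s - a) := fun s hs =>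
      hzero σ hσ a ha s hs.1 z (hzs s hs) (by rwa [hza])
    have hxε : ∀ s ∈ Icc a t, ‖x s‖ < ε :=
      lt_of_forall_le_imp_lt (hx.1.continuousOn.mono hIccD).norm (by linarith) fun s hs h => by
        have h₁ := hβ0 (s - a) (sub_nonneg.2 hs.1)
        have h₂ : η ≤ ε / 2 := min_le_left _ _
        linarith [hnorm s, hzbound s hs, hclose s hs h]
    have htI : t ∈ Icc a t := right_mem_Icc.2 hat
    refine ⟨hxε t htI, fun heq => ?_⟩
    have h₁ := hzbound t htI
    rw [show t - a = T by linarith] at h₁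
    have h₂ : η ≤ δ₁ / 2 := min_le_right _ _
    linarith [hnorm t, hclose t htI fun r hr => (hxε r hr).le]
  have hgrid : ∀ k : ℕ, t₀ + k * T ∈ D → ‖x (t₀ + k * T)‖ ≤ δ₁ := by
    intro k
    induction k with
    | zero => intro _; simpa using hxt₀.trans (min_le_left _ _)
    | succ k ih =>
      intro hk
      have hkT : 0 ≤ k * T := by positivity
      have hnext : t₀ + (k + 1 : ℕ) * T = t₀ + k * T + T := by push_cast; ring
      have hkD : t₀ + k * T ∈ D :=
        hx.1.ordConnected.out ht₀D hk ⟨by linarith, by rw [hnext]; linarith⟩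
      exact (hstep _ hkD (ih hkD) _ hk (by rw [hnext]; linarith) hnext.le).2 hnext
  intro t htD ht
  set k := ⌊(t - t₀) / T⌋₊
  have hk₁ : k * T ≤ t - t₀ :=
    (le_div_iff₀ hT).1 (Nat.floor_le (div_nonneg (sub_nonneg.2 ht) hT.le))
  have hk₂ : t - t₀ < (k + 1) * T := (div_lt_iff₀ hT).1 (Nat.lt_floor_add_one _)
  have hkT : 0 ≤ k * T := by positivity
  have hkD : t₀ + k * T ∈ D := hx.1.ordConnected.out ht₀D htD ⟨by linarith, by linarith⟩
  exact (hstep _ hkD (hgrid k hkD) t htD (by linarith) (by linarith)).1.le
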